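/- arXiv:1809.08124 — 3 statements merged into one kernel-verified Lean document; each statement's English description precedes it below -/
import Mathlib

section
/- For every real t > 0, every real ν, and every natural number n, the n-th derivative with respect to ν of J_ν(t) equals (1/π)·∫₀^π xⁿ·cos(t·sin x − νx − nπ/2) dx − (1/π)·∫₀^∞ e^{−t·sinh x − νx}·[pₙ(x)·sin(πν) + qₙ(x)·cos(πν)] dx. -/
open Real MeasureTheory

/-- Polynomial pₙ(x) = Re[(iπ − x)ⁿ]. -/
noncomputable def pPoly (n : ℕ) (x : ℝ) : ℝ :=
  ∑ k ∈ Finset.range (n / 2 + 1),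
    (n.choose (2 * k) : ℝ) * (-1) ^ (n + k) * π ^ (2 * k) * x ^ (n - 2 * k)

/-- Polynomial qₙ(x) = Im[(iπ − x)ⁿ]. -/
noncomputable def qPoly (n : ℕ) (x : ℝ) : ℝ :=
  ∑ k ∈ Finset.range ((n - 1) / 2 + 1),
    (n.choose (2 * k + 1) : ℝ) * (-1) ^ (n + k + 1) * π ^ (2 * k + 1) * x ^ (n - 2 * k - 1)

/-- Bessel function of the first kind via Schläfli's integral representation. -/
noncomputable def besselJ (ν t : ℝ) : ℝ :=
  (1 / π) * ∫ x in (0:ℝ)..π, Real.cos (t * Real.sin x - ν * x)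
    - (Real.sin (ν * π) / π) * ∫ x in Set.Ioi (0:ℝ), Real.exp (-(t * Real.sinh x) - ν * x)

lemma sum_range_two_mul {M : Type*} [AddCommMonoid M] (f : ℕ → M) (N : ℕ) :
    ∑ m ∈ Finset.range (2 * N), f m = ∑ k ∈ Finset.range N, (f (2 * k) + f (2 * k + 1)) := by
  induction N with
  | zero => simp
  | succ N ih =>
    rw [Nat.mul_succ, Finset.sum_range_succ, Finset.sum_range_succ, ih, Finset.sum_range_succ,
      add_assoc]

lemma pPoly_eq_sum_range_succ (n : ℕ) (x : ℝ) :
    pPoly n x = ∑ k ∈ Finset.range (n + 1),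
      (n.choose (2 * k) : ℝ) * (-1) ^ (n + k) * π ^ (2 * k) * x ^ (n - 2 * k) := by
  refine Finset.sum_subset (Finset.range_subset_range.2 (by omega)) fun k _ hk => ?_
  rw [Finset.mem_range] at hk
  rw [Nat.choose_eq_zero_of_lt (by omega)]
  simp

lemma qPoly_eq_sum_range_succ (n : ℕ) (x : ℝ) :
    qPoly n x = ∑ k ∈ Finset.range (n + 1),
      (n.choose (2 * k + 1) : ℝ) * (-1) ^ (n + k + 1) * π ^ (2 * k + 1) *
        x ^ (n - 2 * k - 1) := by
  refine Finset.sum_subset (Finset.range_subset_range.2 (by omega)) fun k _ hk => ?_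
  rw [Finset.mem_range] at hk
  rw [Nat.choose_eq_zero_of_lt (by omega)]
  simp

lemma pPoly_add_qPoly_mul_I (n : ℕ) (x : ℝ) :
    (pPoly n x : ℂ) + qPoly n x * Complex.I = (π * Complex.I + -x) ^ n := by
  have hsub : Finset.range (n + 1) ⊆ Finset.range (2 * (n + 1)) :=
    Finset.range_subset_range.2 (by omega)
  rw [add_pow, Finset.sum_subset hsub, sum_range_two_mul, pPoly_eq_sum_range_succ,
    qPoly_eq_sum_range_succ]
  · push_cast
    rw [Finset.sum_mul, ← Finset.sum_add_distrib]
    refine Finset.sum_congr rfl fun k _ => ?_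
    have hI : Complex.I ^ (2 * k) = (-1) ^ k := by rw [pow_mul, Complex.I_sq]
    have hI' : Complex.I ^ (2 * k + 1) = (-1) ^ k * Complex.I := by rw [pow_succ, hI]
    congr 1
    · rcases Nat.lt_or_ge n (2 * k) with h | h
      · simp [Nat.choose_eq_zero_of_lt h]
      · obtain ⟨m, rfl⟩ := Nat.exists_eq_add_of_le h
        rw [Nat.add_sub_cancel_left, mul_pow, hI, neg_pow (x : ℂ), pow_add, pow_add,
          pow_mul (-1 : ℂ)]
        ring
    · rcases Nat.lt_or_ge n (2 * k + 1) with h | h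
      · simp [Nat.choose_eq_zero_of_lt h]
      · obtain ⟨m, rfl⟩ := Nat.exists_eq_add_of_le h
        have hm : 2 * k + 1 + m - 2 * k - 1 = m := by omega
        have hsign : (-1 : ℂ) ^ (2 * k + 1 + m + k + 1) = (-1) ^ k * (-1) ^ m := by
          rw [show 2 * k + 1 + m + k + 1 = 2 * (k + 1) + (k + m) by ring, pow_add, pow_mul]
          simp [pow_add]
        rw [hm, Nat.add_sub_cancel_left, mul_pow, hI', neg_pow (x : ℂ), hsign]
        ring
  · intro m _ hm
    rw [Finset.mem_range] at hm
    rw [Nat.choose_eq_zero_of_lt (by omega)]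
    simp

lemma pPoly_eq_re (n : ℕ) (x : ℝ) : pPoly n x = ((π * Complex.I + -x : ℂ) ^ n).re := by
  simp [← pPoly_add_qPoly_mul_I]

lemma qPoly_eq_im (n : ℕ) (x : ℝ) : qPoly n x = ((π * Complex.I + -x : ℂ) ^ n).im := by
  simp [← pPoly_add_qPoly_mul_I]

lemma pPoly_zero (x : ℝ) : pPoly 0 x = 1 := by simp [pPoly_eq_re]

lemma qPoly_zero (x : ℝ) : qPoly 0 x = 0 := by simp [qPoly_eq_im]

lemma pPoly_succ (n : ℕ) (x : ℝ) : pPoly (n + 1) x = -x * pPoly n x - π * qPoly n x := by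
  rw [pPoly_eq_re, pow_succ, ← pPoly_add_qPoly_mul_I]
  simp
  ring

lemma qPoly_succ (n : ℕ) (x : ℝ) : qPoly (n + 1) x = -x * qPoly n x + π * pPoly n x := by
  rw [qPoly_eq_im, pow_succ, ← pPoly_add_qPoly_mul_I]
  simp
  ring

lemma norm_pi_mul_I_sub_le {x : ℝ} (hx : 0 ≤ x) : ‖(π * Complex.I + -x : ℂ)‖ ≤ π + x := by
  refine (norm_add_le _ _).trans_eq ?_
  simp [abs_of_pos pi_pos, abs_of_nonneg hx]

lemma abs_pPoly_le (n : ℕ) {x : ℝ} (hx : 0 ≤ x) : |pPoly n x| ≤ (π + x) ^ n := by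
  rw [pPoly_eq_re]
  refine (Complex.abs_re_le_norm _).trans ?_
  rw [norm_pow]
  exact pow_le_pow_left₀ (norm_nonneg _) (norm_pi_mul_I_sub_le hx) n

lemma abs_qPoly_le (n : ℕ) {x : ℝ} (hx : 0 ≤ x) : |qPoly n x| ≤ (π + x) ^ n := by
  rw [qPoly_eq_im]
  refine (Complex.abs_im_le_norm _).trans ?_
  rw [norm_pow]
  exact pow_le_pow_left₀ (norm_nonneg _) (norm_pi_mul_I_sub_le hx) n

@[fun_prop]
lemma continuous_pPoly (n : ℕ) : Continuous (pPoly n) := by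
  unfold pPoly
  fun_prop

@[fun_prop]
lemma continuous_qPoly (n : ℕ) : Continuous (qPoly n) := by
  unfold qPoly
  fun_prop

lemma sq_div_four_le_sinh {x : ℝ} (hx : 0 ≤ x) : x ^ 2 / 4 ≤ sinh x := by
  have h1 := quadratic_le_exp_of_nonneg hx
  have h2 : exp (-x) ≤ 1 := exp_le_one_iff.2 (by linarith)
  rw [sinh_eq]
  linarith

/-- The kernel `exp (-t sinh x)` beats every exponential on the half line. -/
lemma exp_neg_mul_sinh_add_le {t : ℝ} (ht : 0 < t) (c : ℝ) {x : ℝ} (hx : 0 ≤ x) :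
    exp (-(t * sinh x) + c * x) ≤ exp ((c + 1) ^ 2 / t) * exp (-x) := by
  rw [← exp_add, exp_le_exp]
  have h1 := mul_le_mul_of_nonneg_left (sq_div_four_le_sinh hx) ht.le
  have h2 : 0 ≤ (t * x / 2 - (c + 1)) ^ 2 / t := by positivity
  have h3 : (t * x / 2 - (c + 1)) ^ 2 / t
      = t * (x ^ 2 / 4) - (c + 1) * x + (c + 1) ^ 2 / t := by
    field_simp
    ring
  linarith

lemma integrableOn_exp_neg_mul_sinh_add {t : ℝ} (ht : 0 < t) (c : ℝ) :
    IntegrableOn (fun x => exp (-(t * sinh x) + c * x)) (Set.Ioi 0) := by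
  refine Integrable.mono' ((integrableOn_exp_neg_Ioi 0).const_mul (exp ((c + 1) ^ 2 / t)))
    (by fun_prop) ?_
  filter_upwards [ae_restrict_mem measurableSet_Ioi] with x hx
  rw [norm_of_nonneg (exp_nonneg _)]
  exact exp_neg_mul_sinh_add_le ht c (le_of_lt hx)

/-- The `n`-th `ν`-derivative of `exp (-t sinh x - ν x) sin (π ν)`. -/
noncomputable def schlafliIntegrand (t : ℝ) (n : ℕ) (ν x : ℝ) : ℝ :=
  exp (-(t * sinh x) - ν * x) * (pPoly n x * sin (π * ν) + qPoly n x * cos (π * ν))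

lemma hasDerivAt_schlafliIntegrand (t : ℝ) (n : ℕ) (ν x : ℝ) :
    HasDerivAt (fun ν => schlafliIntegrand t n ν x) (schlafliIntegrand t (n + 1) ν x) ν := by
  have hlin : HasDerivAt (fun ν : ℝ => π * ν) π ν := by
    simpa using (hasDerivAt_id ν).const_mul π
  have hexp : HasDerivAt (fun ν => exp (-(t * sinh x) - ν * x))
      (exp (-(t * sinh x) - ν * x) * (-x)) ν := by
    have := ((hasDerivAt_id ν).mul_const x).const_sub (-(t * sinh x))
    simpa using this.exp
  have := hexp.mul ((hlin.sin.const_mul (pPoly n x)).add (hlin.cos.const_mul (qPoly n x)))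
  refine this.congr_deriv ?_
  simp only [schlafliIntegrand, pPoly_succ, qPoly_succ, Pi.add_apply]
  ring

lemma continuous_schlafliIntegrand (t : ℝ) (n : ℕ) (ν : ℝ) :
    Continuous (schlafliIntegrand t n ν) := by
  unfold schlafliIntegrand
  fun_prop

lemma abs_schlafliIntegrand_le (t : ℝ) (n : ℕ) {ν c x : ℝ} (hν : |ν| ≤ c) (hx : 0 ≤ x) :
    |schlafliIntegrand t n ν x|
      ≤ 2 * n.factorial * exp π * exp (-(t * sinh x) + (c + 1) * x) := by
  have hpow : (π + x) ^ n ≤ n.factorial * exp (π + x) := by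
    have := pow_div_factorial_le_exp (π + x) (by positivity) n
    rwa [div_le_iff₀' (by positivity)] at this
  have hp : |pPoly n x * sin (π * ν)| ≤ (π + x) ^ n := by
    rw [abs_mul]
    exact (mul_le_of_le_one_right (abs_nonneg _) (abs_sin_le_one _)).trans (abs_pPoly_le n hx)
  have hq : |qPoly n x * cos (π * ν)| ≤ (π + x) ^ n := by
    rw [abs_mul]
    exact (mul_le_of_le_one_right (abs_nonneg _) (abs_cos_le_one _)).trans (abs_qPoly_le n hx)
  have hexp : exp (-(t * sinh x) - ν * x) ≤ exp (-(t * sinh x) + c * x) := by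
    rw [exp_le_exp]
    have := mul_le_mul_of_nonneg_right ((neg_le_abs ν).trans hν) hx
    linarith
  rw [schlafliIntegrand, abs_mul, abs_of_pos (exp_pos _)]
  calc _ ≤ exp (-(t * sinh x) + c * x) * (2 * (n.factorial * exp (π + x))) := by
        gcongr
        linarith [abs_add_le (pPoly n x * sin (π * ν)) (qPoly n x * cos (π * ν))]
    _ = _ := by
        rw [show -(t * sinh x) + (c + 1) * x = -(t * sinh x) + c * x + x by ring,
          exp_add (_ + _) x, exp_add π x]
        ring

lemma integrableOn_schlafliIntegrand {t : ℝ} (ht : 0 < t) (n : ℕ) (ν : ℝ) :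
    IntegrableOn (schlafliIntegrand t n ν) (Set.Ioi 0) := by
  refine Integrable.mono' ((integrableOn_exp_neg_mul_sinh_add ht (|ν| + 1)).const_mul
    (2 * n.factorial * exp π)) (continuous_schlafliIntegrand t n ν).aestronglyMeasurable ?_
  filter_upwards [ae_restrict_mem measurableSet_Ioi] with x hx
  exact abs_schlafliIntegrand_le t n le_rfl (le_of_lt hx)

lemma hasDerivAt_integral_schlafliIntegrand {t : ℝ} (ht : 0 < t) (n : ℕ) (ν : ℝ) :
    HasDerivAt (fun ν => ∫ x in Set.Ioi 0, schlafliIntegrand t n ν x)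
      (∫ x in Set.Ioi 0, schlafliIntegrand t (n + 1) ν x) ν := by
  refine (hasDerivAt_integral_of_dominated_loc_of_deriv_le (Metric.ball_mem_nhds ν one_pos)
    (.of_forall fun μ => (continuous_schlafliIntegrand t n μ).aestronglyMeasurable)
    (integrableOn_schlafliIntegrand ht n ν)
    (continuous_schlafliIntegrand t (n + 1) ν).aestronglyMeasurable ?_
    ((integrableOn_exp_neg_mul_sinh_add ht (|ν| + 1 + 1)).const_mul
      (2 * (n + 1).factorial * exp π))
    (.of_forall fun x μ _ => hasDerivAt_schlafliIntegrand t n μ x)).2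
  filter_upwards [ae_restrict_mem measurableSet_Ioi] with x hx μ hμ
  refine abs_schlafliIntegrand_le t (n + 1) ?_ (le_of_lt hx)
  rw [Metric.mem_ball, Real.dist_eq] at hμ
  linarith [abs_sub_abs_le_abs_sub μ ν]

/-- The `n`-th `ν`-derivative of `cos (t sin x - ν x)`. -/
noncomputable def besselIntegrand (t : ℝ) (n : ℕ) (ν x : ℝ) : ℝ :=
  x ^ n * cos (t * sin x - ν * x - n * π / 2)

lemma hasDerivAt_besselIntegrand (t : ℝ) (n : ℕ) (ν x : ℝ) :
    HasDerivAt (fun ν => besselIntegrand t n ν x) (besselIntegrand t (n + 1) ν x) ν := by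
  have hlin : HasDerivAt (fun ν : ℝ => t * sin x - ν * x - n * π / 2) (-x) ν := by
    simpa using (((hasDerivAt_id ν).mul_const x).const_sub (t * sin x)).sub_const (n * π / 2)
  refine (hlin.cos.const_mul (x ^ n)).congr_deriv ?_
  rw [besselIntegrand, Nat.cast_succ,
    show t * sin x - ν * x - (n + 1) * π / 2 = t * sin x - ν * x - n * π / 2 - π / 2 by ring,
    cos_sub_pi_div_two]
  ring

lemma continuous_besselIntegrand (t : ℝ) (n : ℕ) (ν : ℝ) :
    Continuous (besselIntegrand t n ν) := by
  unfold besselIntegrand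
  fun_prop

lemma abs_besselIntegrand_le (t : ℝ) (n : ℕ) (ν x : ℝ) : |besselIntegrand t n ν x| ≤ |x| ^ n := by
  rw [besselIntegrand, abs_mul, abs_pow]
  exact mul_le_of_le_one_right (by positivity) (abs_cos_le_one _)

lemma hasDerivAt_integral_besselIntegrand (t : ℝ) (n : ℕ) (ν : ℝ) :
    HasDerivAt (fun ν => ∫ x in (0 : ℝ)..π, besselIntegrand t n ν x)
      (∫ x in (0 : ℝ)..π, besselIntegrand t (n + 1) ν x) ν :=
  (intervalIntegral.hasDerivAt_integral_of_dominated_loc_of_deriv_le Filter.univ_mem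
    (.of_forall fun μ => (continuous_besselIntegrand t n μ).aestronglyMeasurable)
    ((continuous_besselIntegrand t n ν).intervalIntegrable 0 π)
    (continuous_besselIntegrand t (n + 1) ν).aestronglyMeasurable
    (.of_forall fun x _ μ _ => abs_besselIntegrand_le t (n + 1) μ x)
    ((continuous_abs.pow (n + 1)).intervalIntegrable 0 π)
    (.of_forall fun x _ μ _ => hasDerivAt_besselIntegrand t n μ x)).2

/-- A constant subtracted under a mean over `[0, π]` may be pulled out. -/
lemma mean_sub_const {f : ℝ → ℝ} (hf : Continuous f) (c : ℝ) :
    (1 / π) * ∫ x in (0 : ℝ)..π, (f x - c) = (1 / π) * (∫ x in (0 : ℝ)..π, f x) - c := by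
  rw [intervalIntegral.integral_sub (hf.intervalIntegrable 0 π) intervalIntegrable_const,
    intervalIntegral.integral_const, smul_eq_mul, sub_zero]
  field_simp

lemma besselJ_eq_integral (t ν : ℝ) :
    besselJ ν t = (1 / π) * (∫ x in (0 : ℝ)..π, besselIntegrand t 0 ν x)
      - (1 / π) * ∫ x in Set.Ioi 0, schlafliIntegrand t 0 ν x := by
  rw [besselJ, mean_sub_const (by fun_prop)]
  simp only [besselIntegrand, schlafliIntegrand, pPoly_zero, qPoly_zero,
    integral_mul_const, pow_zero, one_mul, zero_mul, add_zero, Nat.cast_zero, zero_div, sub_zero,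
    mul_comm ν π]
  ring

lemma iteratedDeriv_besselJ_eq_integral {t : ℝ} (ht : 0 < t) (n : ℕ) :
    iteratedDeriv n (fun ν => besselJ ν t) = fun ν =>
      (1 / π) * (∫ x in (0 : ℝ)..π, besselIntegrand t n ν x)
        - (1 / π) * ∫ x in Set.Ioi 0, schlafliIntegrand t n ν x := by
  induction n with
  | zero => exact funext (besselJ_eq_integral t)
  | succ n ih =>
    rw [iteratedDeriv_succ, ih]
    exact funext fun ν => (((hasDerivAt_integral_besselIntegrand t n ν).const_mul _).sub
      ((hasDerivAt_integral_schlafliIntegrand ht n ν).const_mul _)).deriv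

theorem iteratedDeriv_besselJ_order (t : ℝ) (ht : 0 < t) (ν : ℝ) (n : ℕ) :
    iteratedDeriv n (fun ν : ℝ => besselJ ν t) ν
      = (1 / π) * ∫ x in (0:ℝ)..π, x ^ n * Real.cos (t * Real.sin x - ν * x - n * π / 2)
        - (1 / π) * ∫ x in Set.Ioi (0:ℝ),
            Real.exp (-(t * Real.sinh x) - ν * x) *
              (pPoly n x * Real.sin (π * ν) + qPoly n x * Real.cos (π * ν)) := by
  rw [iteratedDeriv_besselJ_eq_integral ht, mean_sub_const (by fun_prop)]
  rfl
end

section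
/- For every real t > 0, every real ν, and every natural number n, the n-th derivative with respect to ν of I_ν(t) equals (1/π)·∫₀^π xⁿ·e^{t·cos x}·cos(νx + nπ/2) dx − (1/π)·∫₀^∞ e^{−t·cosh x − νx}·[pₙ(x)·sin(πν) + qₙ(x)·cos(πν)] dx. -/
open Real MeasureTheory

/-- Modified Bessel function of the first kind via its integral representation. -/
noncomputable def besselI (ν t : ℝ) : ℝ :=
  (1 / π) * ∫ x in (0:ℝ)..π, Real.exp (t * Real.cos x) * Real.cos (ν * x)
    - (Real.sin (ν * π) / π) * ∫ x in Set.Ioi (0:ℝ), Real.exp (-(t * Real.cosh x) - ν * x)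

/-- A power times an exponential is dominated by a faster exponential. -/
lemma norm_ofReal_mul_pow_mul_cexp_le (w : ℝ) (c : ℂ) (n : ℕ) {ν R : ℝ} (hν : |ν| ≤ R) :
    ‖(w : ℂ) * c ^ n * Complex.exp (c * ν)‖ ≤
      (n.factorial : ℝ) * ‖w * Real.exp ((R + 1) * ‖c‖)‖ := by
  have hpow : ‖c‖ ^ n ≤ n.factorial * Real.exp ‖c‖ := by
    have := Real.pow_div_factorial_le_exp _ (norm_nonneg c) n
    rwa [div_le_iff₀' (by positivity)] at this
  have hexp : ‖Complex.exp (c * ν)‖ ≤ Real.exp (R * ‖c‖) := by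
    rw [Complex.norm_exp]
    refine Real.exp_le_exp.2 ((Complex.re_le_norm _).trans ?_)
    rw [norm_mul, Complex.norm_real, Real.norm_eq_abs, mul_comm]
    gcongr
  calc ‖(w : ℂ) * c ^ n * Complex.exp (c * ν)‖
      = ‖w‖ * ‖c‖ ^ n * ‖Complex.exp (c * ν)‖ := by
        rw [norm_mul, norm_mul, norm_pow, Complex.norm_real]
    _ ≤ ‖w‖ * (n.factorial * Real.exp ‖c‖) * Real.exp (R * ‖c‖) := by gcongr
    _ = n.factorial * ‖w * Real.exp ((R + 1) * ‖c‖)‖ := by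
        rw [norm_mul, Real.norm_of_nonneg (Real.exp_nonneg ((R + 1) * ‖c‖)),
          show (R + 1) * ‖c‖ = ‖c‖ + R * ‖c‖ by ring, Real.exp_add]
        ring

section ExponentialIntegral

variable {α : Type*} [MeasurableSpace α] {μ : Measure α} {w : α → ℝ} {c : α → ℂ}

lemma aestronglyMeasurable_ofReal_mul_pow_mul_cexp (hw : AEStronglyMeasurable w μ)
    (hc : AEStronglyMeasurable c μ) (n : ℕ) (ν : ℝ) :
    AEStronglyMeasurable (fun x => (w x : ℂ) * c x ^ n * Complex.exp (c x * ν)) μ :=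
  ((Complex.continuous_ofReal.comp_aestronglyMeasurable hw).mul (hc.pow n)).mul
    (Complex.continuous_exp.comp_aestronglyMeasurable (hc.mul_const _))

lemma integrable_ofReal_mul_pow_mul_cexp (hw : AEStronglyMeasurable w μ)
    (hc : AEStronglyMeasurable c μ)
    (h : ∀ R : ℝ, 0 ≤ R → Integrable (fun x => w x * Real.exp (R * ‖c x‖)) μ) (n : ℕ) (ν : ℝ) :
    Integrable (fun x => (w x : ℂ) * c x ^ n * Complex.exp (c x * ν)) μ :=
  ((h (|ν| + 1) (by positivity)).norm.const_mul _).mono'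
    (aestronglyMeasurable_ofReal_mul_pow_mul_cexp hw hc n ν)
    (.of_forall fun x => norm_ofReal_mul_pow_mul_cexp_le (w x) (c x) n le_rfl)

/-- Differentiation under the integral sign for exponential integrals. -/
lemma hasDerivAt_integral_ofReal_mul_pow_mul_cexp (hw : AEStronglyMeasurable w μ)
    (hc : AEStronglyMeasurable c μ)
    (h : ∀ R : ℝ, 0 ≤ R → Integrable (fun x => w x * Real.exp (R * ‖c x‖)) μ) (n : ℕ) (ν : ℝ) :
    HasDerivAt (fun ν : ℝ => ∫ x, (w x : ℂ) * c x ^ n * Complex.exp (c x * ν) ∂μ)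
      (∫ x, (w x : ℂ) * c x ^ (n + 1) * Complex.exp (c x * ν) ∂μ) ν := by
  refine (hasDerivAt_integral_of_dominated_loc_of_deriv_le (Metric.ball_mem_nhds ν one_pos)
    (.of_forall fun s => aestronglyMeasurable_ofReal_mul_pow_mul_cexp hw hc n s)
    (integrable_ofReal_mul_pow_mul_cexp hw hc h n ν)
    (F' := fun (s : ℝ) x => (w x : ℂ) * c x ^ (n + 1) * Complex.exp (c x * s))
    (aestronglyMeasurable_ofReal_mul_pow_mul_cexp hw hc (n + 1) ν)
    (.of_forall fun x s hs => norm_ofReal_mul_pow_mul_cexp_le (w x) (c x) (n + 1)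
      (R := |ν| + 1) ?_)
    ((h (|ν| + 1 + 1) (by positivity)).norm.const_mul _)
    (.of_forall fun x s _ => ?_)).2
  · rw [Metric.mem_ball, Real.dist_eq] at hs
    have := abs_add_le (s - ν) ν
    rw [sub_add_cancel] at this
    linarith
  · have hlin : HasDerivAt (fun s : ℝ => c x * (s : ℂ)) (c x) s := by
      simpa using (Complex.ofRealCLM.hasDerivAt (x := s)).const_mul (c x)
    exact (hlin.cexp.const_mul ((w x : ℂ) * c x ^ n)).congr_deriv (by ring)

end ExponentialIntegral

lemma Finset.sum_range_two_mul_eq_sum_even_add_odd {M : Type*} [AddCommMonoid M] (f : ℕ → M)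
    (N : ℕ) :
    ∑ m ∈ Finset.range (2 * N), f m =
      ∑ k ∈ Finset.range N, f (2 * k) + ∑ k ∈ Finset.range N, f (2 * k + 1) := by
  induction N with
  | zero => simp
  | succ N ih =>
    rw [show 2 * (N + 1) = 2 * N + 1 + 1 by ring, Finset.sum_range_succ, Finset.sum_range_succ, ih,
      Finset.sum_range_succ, Finset.sum_range_succ]
    abel

lemma pi_mul_I_sub_pow (n : ℕ) (x : ℝ) :
    ((π : ℂ) * Complex.I - x) ^ n = pPoly n x + qPoly n x * Complex.I := by
  set f : ℕ → ℂ := fun m => ((π : ℂ) * Complex.I) ^ m * (-(x : ℂ)) ^ (n - m) * n.choose m with hf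
  have hzero : ∀ m, n < m → f m = 0 := fun m hm => by simp [hf, Nat.choose_eq_zero_of_lt hm]
  have heven : ∑ k ∈ Finset.range (n / 2 + 1), f (2 * k) = pPoly n x := by
    rw [pPoly, Complex.ofReal_sum]
    refine Finset.sum_congr rfl fun k hk => ?_
    obtain ⟨j, rfl⟩ : ∃ j, n = 2 * k + j :=
      Nat.exists_eq_add_of_le (by have := Finset.mem_range.1 hk; omega)
    simp only [hf, Nat.add_sub_cancel_left, mul_pow, pow_mul, Complex.I_sq]
    rw [neg_pow (x : ℂ), pow_add, pow_add, pow_mul]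
    push_cast
    ring
  have hodd : ∑ k ∈ Finset.range (n / 2 + 1), f (2 * k + 1) = qPoly n x * Complex.I := by
    rw [← Finset.sum_subset (s₁ := Finset.range ((n - 1) / 2 + 1))
      (Finset.range_mono (by omega)) (fun k _ hk => hzero _ (by
        rw [Finset.mem_range] at hk; omega)), qPoly, Complex.ofReal_sum, Finset.sum_mul]
    refine Finset.sum_congr rfl fun k _ => ?_
    rcases lt_or_ge n (2 * k + 1) with hk | hk
    · rw [hzero _ hk, Nat.choose_eq_zero_of_lt hk]
      simp
    obtain ⟨j, rfl⟩ : ∃ j, n = 2 * k + 1 + j := Nat.exists_eq_add_of_le hk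
    have hsub : 2 * k + 1 + j - 2 * k - 1 = j := by omega
    have hI : Complex.I ^ (2 * k) = (-1) ^ k := by rw [pow_mul, Complex.I_sq]
    have hneg : (-1 : ℂ) ^ (2 * k + 1 + j + k + 1) = (-1) ^ k * (-1) ^ j := by
      rw [show 2 * k + 1 + j + k + 1 = 2 * (k + 1) + (k + j) by ring, pow_add, pow_mul,
        neg_one_sq, one_pow, one_mul, pow_add]
    simp only [hf, hsub, Nat.add_sub_cancel_left, mul_pow, pow_succ Complex.I, hI]
    rw [neg_pow (x : ℂ)]
    push_cast
    rw [hneg]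
    ring
  rw [sub_eq_add_neg, add_pow, ← heven, ← hodd, ← Finset.sum_range_two_mul_eq_sum_even_add_odd]
  refine Finset.sum_subset (Finset.range_mono (by omega)) fun m _ hm => hzero m ?_
  rw [Finset.mem_range] at hm
  omega

lemma sq_div_four_le_cosh {x : ℝ} (hx : 0 ≤ x) : x ^ 2 / 4 ≤ Real.cosh x := by
  have hexp := Real.pow_div_factorial_le_exp _ hx 2
  have hpos := Real.exp_pos (-x)
  norm_num at hexp
  rw [Real.cosh_eq]
  linarith

lemma integrableOn_exp_neg_mul_cosh_mul_exp_norm {t : ℝ} (ht : 0 < t) {R : ℝ} (hR : 0 ≤ R) :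
    IntegrableOn (fun x : ℝ => Real.exp (-(t * Real.cosh x)) *
      Real.exp (R * ‖(π : ℂ) * Complex.I - x‖)) (Set.Ioi 0) := by
  have hgauss := ((integrable_exp_neg_mul_sq (b := t / 8) (by positivity)).const_mul
    (Real.exp (R * π + 2 * R ^ 2 / t))).integrableOn (s := Set.Ioi 0)
  refine hgauss.mono' (Continuous.aestronglyMeasurable (by fun_prop)) ?_
  refine (ae_restrict_mem measurableSet_Ioi).mono fun x hx => ?_
  have hx0 : (0 : ℝ) ≤ x := le_of_lt hx
  have hnorm : ‖(π : ℂ) * Complex.I - x‖ ≤ π + x := by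
    refine (norm_sub_le _ _).trans_eq ?_
    simp [abs_of_nonneg hx0, abs_of_pos Real.pi_pos]
  have hcosh := mul_le_mul_of_nonneg_left (sq_div_four_le_cosh hx0) ht.le
  have hR' := mul_le_mul_of_nonneg_left hnorm hR
  have hsq : R * x ≤ t / 8 * x ^ 2 + 2 * R ^ 2 / t := by
    have : t / 8 * x ^ 2 + 2 * R ^ 2 / t - R * x = (t * x - 4 * R) ^ 2 / (8 * t) := by
      field_simp
      ring
    have : 0 ≤ (t * x - 4 * R) ^ 2 / (8 * t) := by positivity
    linarith
  rw [← Real.exp_add, ← Real.exp_add, Real.norm_of_nonneg (Real.exp_nonneg _)]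
  refine Real.exp_le_exp.2 ?_
  nlinarith

lemma integrableOn_exp_mul_cos_mul_exp_norm (t R : ℝ) :
    IntegrableOn (fun x : ℝ => Real.exp (t * Real.cos x) *
      Real.exp (R * ‖(x : ℂ) * Complex.I‖)) (Set.Ioc 0 π) :=
  (Continuous.integrableOn_Icc (by fun_prop)).mono_set Set.Ioc_subset_Icc_self

lemma re_ofReal_mul_pow_mul_cexp_mul_I (w x ν : ℝ) (n : ℕ) :
    ((w : ℂ) * ((x : ℂ) * Complex.I) ^ n * Complex.exp ((x : ℂ) * Complex.I * ν)).re =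
      x ^ n * w * Real.cos (ν * x + n * π / 2) := by
  have hI : (Complex.I : ℂ) ^ n = Complex.exp ((n * π / 2 : ℝ) * Complex.I) := by
    conv_lhs => rw [← Complex.exp_pi_div_two_mul_I, ← Complex.exp_nat_mul]
    congr 1
    push_cast
    ring
  have : (w : ℂ) * ((x : ℂ) * Complex.I) ^ n * Complex.exp ((x : ℂ) * Complex.I * ν) =
      ((x ^ n * w : ℝ) : ℂ) * Complex.exp ((ν * x + n * π / 2 : ℝ) * Complex.I) := by
    rw [mul_pow, hI, Complex.ofReal_add, add_mul, Complex.exp_add]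
    push_cast
    rw [show (x : ℂ) * Complex.I * ν = ν * x * Complex.I by ring]
    ring
  rw [this, Complex.re_ofReal_mul, Complex.exp_ofReal_mul_I_re]

lemma im_ofReal_mul_pow_mul_cexp_pi_mul_I_sub (w x ν : ℝ) (n : ℕ) :
    ((w : ℂ) * ((π : ℂ) * Complex.I - x) ^ n *
        Complex.exp (((π : ℂ) * Complex.I - x) * ν)).im =
      w * Real.exp (-(ν * x)) *
        (pPoly n x * Real.sin (π * ν) + qPoly n x * Real.cos (π * ν)) := by
  have hexp : Complex.exp (((π : ℂ) * Complex.I - x) * ν) =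
      (Real.exp (-(ν * x)) : ℂ) * Complex.exp ((π * ν : ℝ) * Complex.I) := by
    rw [Complex.ofReal_exp, ← Complex.exp_add]
    congr 1
    push_cast
    ring
  have : (w : ℂ) * ((π : ℂ) * Complex.I - x) ^ n * Complex.exp (((π : ℂ) * Complex.I - x) * ν) =
      ((w * Real.exp (-(ν * x)) : ℝ) : ℂ) *
        ((pPoly n x + qPoly n x * Complex.I) * Complex.exp ((π * ν : ℝ) * Complex.I)) := by
    rw [hexp, pi_mul_I_sub_pow]
    push_cast
    ring
  rw [this, Complex.im_ofReal_mul, Complex.mul_im, Complex.exp_ofReal_mul_I_re,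
    Complex.exp_ofReal_mul_I_im]
  simp

/-- Subtracting a constant inside the normalized integral over `[0, π]` subtracts it outside. -/
lemma one_div_pi_mul_integral_sub_const {f : ℝ → ℝ} (hf : Continuous f) (C : ℝ) :
    (1 / π) * (∫ x in (0:ℝ)..π, (f x - C)) = (1 / π) * (∫ x in (0:ℝ)..π, f x) - C := by
  rw [intervalIntegral.integral_sub (hf.intervalIntegrable _ _) intervalIntegrable_const,
    intervalIntegral.integral_const, sub_zero, smul_eq_mul]
  field_simp

/-- The exponential integral whose real part is the integral over `[0, π]`. -/
noncomputable def besselCosIntegral (t : ℝ) (n : ℕ) (ν : ℝ) : ℂ :=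
  ∫ x in Set.Ioc 0 π, (Real.exp (t * Real.cos x) : ℂ) * ((x : ℂ) * Complex.I) ^ n *
    Complex.exp ((x : ℂ) * Complex.I * ν)

/-- The exponential integral whose imaginary part is the integral over `(0, ∞)`. -/
noncomputable def besselCoshIntegral (t : ℝ) (n : ℕ) (ν : ℝ) : ℂ :=
  ∫ x in Set.Ioi (0:ℝ), (Real.exp (-(t * Real.cosh x)) : ℂ) * ((π : ℂ) * Complex.I - x) ^ n *
    Complex.exp (((π : ℂ) * Complex.I - x) * ν)

lemma hasDerivAt_besselCosIntegral (t : ℝ) (n : ℕ) (ν : ℝ) :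
    HasDerivAt (besselCosIntegral t n) (besselCosIntegral t (n + 1) ν) ν :=
  hasDerivAt_integral_ofReal_mul_pow_mul_cexp (w := fun x => Real.exp (t * Real.cos x))
    (c := fun x : ℝ => (x : ℂ) * Complex.I) (Continuous.aestronglyMeasurable (by fun_prop))
    (Continuous.aestronglyMeasurable (by fun_prop))
    (fun R _ => integrableOn_exp_mul_cos_mul_exp_norm t R) n ν

lemma hasDerivAt_besselCoshIntegral {t : ℝ} (ht : 0 < t) (n : ℕ) (ν : ℝ) :
    HasDerivAt (besselCoshIntegral t n) (besselCoshIntegral t (n + 1) ν) ν :=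
  hasDerivAt_integral_ofReal_mul_pow_mul_cexp (w := fun x => Real.exp (-(t * Real.cosh x)))
    (c := fun x : ℝ => (π : ℂ) * Complex.I - x) (Continuous.aestronglyMeasurable (by fun_prop))
    (Continuous.aestronglyMeasurable (by fun_prop))
    (fun _ hR => integrableOn_exp_neg_mul_cosh_mul_exp_norm ht hR) n ν

lemma re_besselCosIntegral (t : ℝ) (n : ℕ) (ν : ℝ) :
    (besselCosIntegral t n ν).re =
      ∫ x in (0:ℝ)..π, x ^ n * Real.exp (t * Real.cos x) * Real.cos (ν * x + n * π / 2) := by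
  rw [intervalIntegral.integral_of_le Real.pi_pos.le]
  refine (integral_re (𝕜 := ℂ) (integrable_ofReal_mul_pow_mul_cexp
    (μ := volume.restrict (Set.Ioc 0 π)) (w := fun x => Real.exp (t * Real.cos x))
    (c := fun x : ℝ => (x : ℂ) * Complex.I) (Continuous.aestronglyMeasurable (by fun_prop))
    (Continuous.aestronglyMeasurable (by fun_prop))
    (fun R _ => integrableOn_exp_mul_cos_mul_exp_norm t R) n ν)).symm.trans ?_
  exact integral_congr_ae (.of_forall fun x => re_ofReal_mul_pow_mul_cexp_mul_I _ x ν n)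

lemma im_besselCoshIntegral {t : ℝ} (ht : 0 < t) (n : ℕ) (ν : ℝ) :
    (besselCoshIntegral t n ν).im =
      ∫ x in Set.Ioi (0:ℝ), Real.exp (-(t * Real.cosh x) - ν * x) *
        (pPoly n x * Real.sin (π * ν) + qPoly n x * Real.cos (π * ν)) := by
  refine (integral_im (𝕜 := ℂ) (integrable_ofReal_mul_pow_mul_cexp
    (μ := volume.restrict (Set.Ioi 0)) (w := fun x => Real.exp (-(t * Real.cosh x)))
    (c := fun x : ℝ => (π : ℂ) * Complex.I - x) (Continuous.aestronglyMeasurable (by fun_prop))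
    (Continuous.aestronglyMeasurable (by fun_prop))
    (fun _ hR => integrableOn_exp_neg_mul_cosh_mul_exp_norm ht hR) n ν)).symm.trans ?_
  refine integral_congr_ae (.of_forall fun x => ?_)
  refine (im_ofReal_mul_pow_mul_cexp_pi_mul_I_sub _ x ν n).trans ?_
  rw [← Real.exp_add, ← sub_eq_add_neg]

lemma besselI_eq_re_sub_im {t : ℝ} (ht : 0 < t) (ν : ℝ) :
    besselI ν t = (1 / π) * (besselCosIntegral t 0 ν).re -
      (1 / π) * (besselCoshIntegral t 0 ν).im := by
  rw [besselI, one_div_pi_mul_integral_sub_const (by fun_prop), re_besselCosIntegral,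
    im_besselCoshIntegral ht]
  simp only [pPoly, qPoly]
  simp [integral_mul_const, mul_comm π ν]
  ring

lemma iteratedDeriv_besselI_eq_re_sub_im {t : ℝ} (ht : 0 < t) (n : ℕ) :
    iteratedDeriv n (fun ν : ℝ => besselI ν t) = fun ν =>
      (1 / π) * (besselCosIntegral t n ν).re - (1 / π) * (besselCoshIntegral t n ν).im := by
  induction n with
  | zero => exact funext fun ν => besselI_eq_re_sub_im ht ν
  | succ n ih =>
    rw [iteratedDeriv_succ, ih]
    refine funext fun ν => HasDerivAt.deriv ?_
    exact ((Complex.reCLM.hasFDerivAt.comp_hasDerivAt ν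
      (hasDerivAt_besselCosIntegral t n ν)).const_mul _).sub
      ((Complex.imCLM.hasFDerivAt.comp_hasDerivAt ν
        (hasDerivAt_besselCoshIntegral ht n ν)).const_mul _)

theorem iteratedDeriv_besselI_order (t : ℝ) (ht : 0 < t) (ν : ℝ) (n : ℕ) :
    iteratedDeriv n (fun ν : ℝ => besselI ν t) ν
      = (1 / π) * ∫ x in (0:ℝ)..π, x ^ n * Real.exp (t * Real.cos x) * Real.cos (ν * x + n * π / 2)
        - (1 / π) * ∫ x in Set.Ioi (0:ℝ),
            Real.exp (-(t * Real.cosh x) - ν * x) *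
              (pPoly n x * Real.sin (π * ν) + qPoly n x * Real.cos (π * ν)) := by
  rw [one_div_pi_mul_integral_sub_const (by fun_prop), iteratedDeriv_besselI_eq_re_sub_im ht,
    ← re_besselCosIntegral, ← im_besselCoshIntegral ht]
end

section
/- For every real t > 0 and every natural number m, (∂Y_ν(t)/∂ν)|_{ν=m} + (−1)^m·(∂Y_ν(t)/∂ν)|_{ν=−m} = −π·J_m(t). -/
open Real MeasureTheory

/-- Bessel function of the second kind via its integral representation. -/
noncomputable def besselY (ν t : ℝ) : ℝ :=
  (1 / π) * ∫ x in (0:ℝ)..π, Real.sin (t * Real.sin x - ν * x)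
    - (1 / π) * ∫ x in Set.Ioi (0:ℝ),
        Real.exp (-(t * Real.sinh x)) *
          (Real.exp (ν * x) + Real.exp (-(ν * x)) * Real.cos (ν * π))

/-- The Laplace-type transform `∫₀^∞ exp (-t sinh x + ν x) dx` occurring in `besselY`. -/
noncomputable def sinhLaplace (t ν : ℝ) : ℝ :=
  ∫ x in Set.Ioi (0:ℝ), exp (-(t * sinh x)) * exp (ν * x)

lemma integrableOn_exp_neg_sinh_mul_exp {t : ℝ} (ht : 0 < t) (ν : ℝ) :
    IntegrableOn (fun x => exp (-(t * sinh x)) * exp (ν * x)) (Set.Ioi 0) := by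
  refine integrable_of_isBigO_exp_neg one_pos (by fun_prop) ?_
  refine Asymptotics.IsBigO.of_bound 1 ?_
  filter_upwards [Filter.eventually_ge_atTop 0,
    Filter.eventually_ge_atTop (4 * (ν + 1) / t)] with x hx0 hx
  rw [← exp_add, norm_of_nonneg (exp_pos _).le, norm_of_nonneg (exp_pos _).le, one_mul, exp_le_exp]
  have h1 := mul_le_mul_of_nonneg_left (sq_div_four_le_sinh hx0) ht.le
  rw [div_le_iff₀ ht] at hx
  nlinarith [mul_le_mul_of_nonneg_right hx hx0]

lemma differentiable_sinhLaplace {t : ℝ} (ht : 0 < t) : Differentiable ℝ (sinhLaplace t) := by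
  set f : ℝ → ENNReal := fun x => ENNReal.ofReal (exp (-(t * sinh x)))
  have hf : Measurable f := by
    apply Measurable.ennreal_ofReal
    fun_prop
  have hf_toReal (x : ℝ) : (f x).toReal = exp (-(t * sinh x)) :=
    ENNReal.toReal_ofReal (exp_pos _).le
  have hf_lt : ∀ᵐ x ∂(volume.restrict (Set.Ioi (0:ℝ))), f x < ⊤ :=
    ae_of_all _ fun _ => ENNReal.ofReal_lt_top
  set μ := (volume.restrict (Set.Ioi (0:ℝ))).withDensity f with hμ
  have h_mgf : sinhLaplace t = ProbabilityTheory.mgf id μ := by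
    funext ν
    rw [ProbabilityTheory.mgf, hμ, integral_withDensity_eq_integral_toReal_smul hf hf_lt]
    simp only [hf_toReal, smul_eq_mul, id, sinhLaplace]
  have h_univ : ProbabilityTheory.integrableExpSet id μ = Set.univ := by
    refine Set.eq_univ_of_forall fun ν => ?_
    change Integrable _ μ
    rw [hμ, integrable_withDensity_iff_integrable_smul' hf hf_lt]
    simp only [hf_toReal, smul_eq_mul, id]
    exact integrableOn_exp_neg_sinh_mul_exp ht ν
  rw [h_mgf]
  exact fun ν => ProbabilityTheory.differentiableAt_mgf (by simp [h_univ])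

lemma besselY_eq {t : ℝ} (ht : 0 < t) (ν : ℝ) :
    besselY ν t = (1 / π) * ((∫ x in (0:ℝ)..π, sin (t * sin x - ν * x))
      - (sinhLaplace t ν + cos (ν * π) * sinhLaplace t (-ν))) := by
  have h : (∫ x in Set.Ioi (0:ℝ), exp (-(t * sinh x)) *
      (exp (ν * x) + exp (-(ν * x)) * cos (ν * π)))
      = sinhLaplace t ν + cos (ν * π) * sinhLaplace t (-ν) := by
    rw [sinhLaplace, sinhLaplace, ← integral_const_mul, ← integral_add
      (integrableOn_exp_neg_sinh_mul_exp ht ν)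
      ((integrableOn_exp_neg_sinh_mul_exp ht (-ν)).const_mul _)]
    refine integral_congr_ae (ae_of_all _ fun x => ?_)
    simp only [neg_mul]
    ring
  rw [besselY, h, intervalIntegral.integral_sub
    (Continuous.intervalIntegrable (by fun_prop) _ _) intervalIntegrable_const,
    intervalIntegral.integral_const]
  simp only [sub_zero, smul_eq_mul]
  field_simp

lemma besselJ_natCast (m : ℕ) (t : ℝ) :
    besselJ m t = (1 / π) * ∫ x in (0:ℝ)..π, cos (t * sin x - m * x) := by
  simp [besselJ, sin_nat_mul_pi]

lemma hasDerivAt_integral_sin (t ν : ℝ) :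
    HasDerivAt (fun ν : ℝ => ∫ x in (0:ℝ)..π, sin (t * sin x - ν * x))
      (-∫ x in (0:ℝ)..π, x * cos (t * sin x - ν * x)) ν := by
  rw [← intervalIntegral.integral_neg]
  refine (intervalIntegral.hasDerivAt_integral_of_dominated_loc_of_deriv_le
    (F' := fun ν x => -(x * cos (t * sin x - ν * x))) (bound := fun x => |x|) Filter.univ_mem
    (.of_forall fun _ => Continuous.aestronglyMeasurable (by fun_prop))
    (Continuous.intervalIntegrable (by fun_prop) _ _)
    (Continuous.aestronglyMeasurable (by fun_prop)) ?_
    (Continuous.intervalIntegrable (by fun_prop) _ _) ?_).2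
  · refine ae_of_all _ fun x _ ν _ => ?_
    rw [norm_neg, norm_mul, norm_eq_abs, norm_eq_abs]
    exact mul_le_of_le_one_right (abs_nonneg _) (abs_cos_le_one _)
  · refine ae_of_all _ fun x _ ν _ => ?_
    have h := (((hasDerivAt_id ν).mul_const x).const_sub (t * sin x)).sin
    exact h.congr_deriv (by simp only [id]; ring)

lemma hasDerivAt_besselY_of_sin_eq_zero {t : ℝ} (ht : 0 < t) {ν : ℝ} (hν : sin (ν * π) = 0) :
    HasDerivAt (fun ν : ℝ => besselY ν t)
      ((1 / π) * ((-∫ x in (0:ℝ)..π, x * cos (t * sin x - ν * x))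
        - (deriv (sinhLaplace t) ν - cos (ν * π) * deriv (sinhLaplace t) (-ν)))) ν := by
  have hE (ν : ℝ) := (differentiable_sinhLaplace ht ν).hasDerivAt
  have hcos := ((hasDerivAt_id ν).mul_const π).cos
  have hneg := (hE (-ν)).comp ν (hasDerivAt_neg ν)
  have h := ((hasDerivAt_integral_sin t ν).sub ((hE ν).add (hcos.mul hneg))).const_mul (1 / π)
  refine (h.congr_deriv ?_).congr_of_eventuallyEq (.of_forall fun ν => ?_)
  · simp only [id, hν]
    ring
  · simp [besselY_eq ht]

lemma integral_mul_cos_reflection (t : ℝ) (m : ℕ) :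
    ∫ x in (0:ℝ)..π, x * cos (t * sin x - -(m:ℝ) * x)
      = (-1) ^ m * ∫ x in (0:ℝ)..π, (π - x) * cos (t * sin x - m * x) := by
  have h := intervalIntegral.integral_comp_sub_left (a := 0) (b := π)
    (fun x => x * cos (t * sin x - -(m:ℝ) * x)) π
  rw [sub_self, sub_zero] at h
  rw [← h, ← intervalIntegral.integral_const_mul]
  refine intervalIntegral.integral_congr fun x _ => ?_
  have : t * sin (π - x) - -(m:ℝ) * (π - x) = t * sin x - m * x + m * π := by
    rw [sin_pi_sub]
    ring
  simp only [this, cos_add_nat_mul_pi]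
  ring

theorem reflection_deriv_besselY (t : ℝ) (ht : 0 < t) (m : ℕ) :
    deriv (fun ν : ℝ => besselY ν t) m
      + (-1 : ℝ) ^ m * deriv (fun ν : ℝ => besselY ν t) (-(m : ℝ))
      = -π * besselJ m t := by
  have hs : (-1 : ℝ) ^ m * (-1) ^ m = 1 := by rw [← mul_pow]; norm_num
  have hm := (hasDerivAt_besselY_of_sin_eq_zero ht (sin_nat_mul_pi m)).deriv
  have hm' := (hasDerivAt_besselY_of_sin_eq_zero ht (ν := -(m : ℝ)) (by simp)).deriv
  rw [integral_mul_cos_reflection] at hm'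
  rw [hm, hm', besselJ_natCast]
  have hsum : (∫ x in (0:ℝ)..π, x * cos (t * sin x - m * x))
      + (∫ x in (0:ℝ)..π, (π - x) * cos (t * sin x - m * x))
      = π * ∫ x in (0:ℝ)..π, cos (t * sin x - m * x) := by
    rw [← intervalIntegral.integral_add (Continuous.intervalIntegrable (by fun_prop) _ _)
      (Continuous.intervalIntegrable (by fun_prop) _ _), ← intervalIntegral.integral_const_mul]
    refine intervalIntegral.integral_congr fun x _ => ?_
    ring
  simp only [neg_mul, cos_neg, cos_nat_mul_pi, neg_neg]
  linear_combination (-(1 / π)) * hsum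
    + (-(1 / π) * (∫ x in (0:ℝ)..π, (π - x) * cos (t * sin x - m * x))
    + (1 / π) * deriv (sinhLaplace t) m) * hs
end
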